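/- Suppose θ has the NOF property. Let v ∈ I(θ) with ℓ^θ(v) = 1. Then v covers at most one twisted identity in Br(I(θ)); that is, there is at most one u ∈ ι(θ) such that u < v in the Bruhat order and there exists no w ∈ I(θ) with u < w < v. -/

import Mathlib

namespace TwistedIdentitiesPaper

open scoped Classical

variable {B : Type*} {W : Type*} [Group W] {M : CoxeterMatrix B}

/-- The Bruhat order on `W`, defined via the subword property: `u ≤ v` iff every
reduced expression for `v` contains a subword representing `u`. -/
def bruhatLE (cs : CoxeterSystem M W) (u v : W) : Prop :=
  ∀ l : List B, cs.IsReduced l → cs.wordProd l = v →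
    ∃ l' : List B, l'.Sublist l ∧ cs.wordProd l' = u

/-- The strict Bruhat order. -/
def bruhatLT (cs : CoxeterSystem M W) (u v : W) : Prop :=
  bruhatLE cs u v ∧ u ≠ v

/-- The action `w ↦ w ⋅ s̲ᵢ`: `w ⋅ s̲ᵢ = w sᵢ` if `θ(sᵢ) w sᵢ = w`, and
`w ⋅ s̲ᵢ = θ(sᵢ) w sᵢ` otherwise. -/
noncomputable def twistAct (cs : CoxeterSystem M W) (θ : W ≃* W) (w : W) (i : B) : W :=
  if θ (cs.simple i) * w * cs.simple i = w then w * cs.simple i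
  else θ (cs.simple i) * w * cs.simple i

/-- `e ⋅ s̲₁ ⋯ s̲ₖ` for a word `s₁ ⋯ sₖ`. -/
noncomputable def twistProd (cs : CoxeterSystem M W) (θ : W ≃* W) (l : List B) : W :=
  l.foldl (twistAct cs θ) 1

/-- The set of twisted involutions `I(θ) = {w : θ(w) = w⁻¹}`. -/
def twistedInvolutions (θ : W ≃* W) : Set W := {w | θ w = w⁻¹}

/-- The set of twisted identities `ι(θ) = {θ(w⁻¹) w : w ∈ W}`. -/
def twistedIdentities (θ : W ≃* W) : Set W := {w | ∃ v : W, w = θ v⁻¹ * v}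

/-- The rank `ρ(w)` of a twisted involution: the least `k` such that
`w = e ⋅ s̲₁ ⋯ s̲ₖ`. -/
noncomputable def twistRank (cs : CoxeterSystem M W) (θ : W ≃* W) (w : W) : ℕ :=
  sInf {k | ∃ l : List B, l.length = k ∧ twistProd cs θ l = w}

/-- `θ` has the no-odd-flip (NOF) property: for every `s ∈ S` with `θ(s) ≠ s`,
the order of `s θ(s)` is even or infinite. -/
def NOF (cs : CoxeterSystem M W) (θ : W ≃* W) : Prop :=
  ∀ i : B, θ (cs.simple i) ≠ cs.simple i →
    Even (orderOf (cs.simple i * θ (cs.simple i))) ∨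
      orderOf (cs.simple i * θ (cs.simple i)) = 0


namespace SignedConj

variable (cs : CoxeterSystem M W)

/-- The generator `sᵢ` acting on `W × {±1}` by conjugation, flipping the sign exactly at `sᵢ`. -/
noncomputable def simplePerm (i : B) : Equiv.Perm (W × ZMod 2) :=
  Function.Involutive.toPerm
    (fun x ↦ (cs.simple i * x.1 * cs.simple i, x.2 + if x.1 = cs.simple i then 1 else 0)) (by
      rintro ⟨t, e⟩
      have h : cs.simple i * t * cs.simple i = cs.simple i ↔ t = cs.simple i := by
        constructor
        · intro h
          have h' : cs.simple i * t = 1 := by simpa using h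
          rw [eq_inv_of_mul_eq_one_right h', cs.inv_simple]
        · rintro rfl
          simp
      simp only [h]
      ext
      · simp [mul_assoc]
      · simp only [add_assoc, CharTwo.add_self_eq_zero, add_zero])

theorem simplePerm_apply (i : B) (t : W) (e : ZMod 2) :
    simplePerm cs i (t, e) =
      (cs.simple i * t * cs.simple i, e + if t = cs.simple i then 1 else 0) := rfl

theorem simplePerm_mul_pow_apply (i j : B) (n : ℕ) (t : W) (e : ZMod 2) :
    ((simplePerm cs i * simplePerm cs j) ^ n) (t, e) =
      ((cs.simple i * cs.simple j) ^ n * t * ((cs.simple i * cs.simple j) ^ n)⁻¹,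
        e + ∑ k ∈ Finset.range (2 * n),
          if t = cs.simple j * (cs.simple i * cs.simple j) ^ k then 1 else 0) := by
  induction n with
  | zero => simp
  | succ n ih =>
    set a := cs.simple i with ha
    set b := cs.simple j with hb
    have haa : a⁻¹ = a := cs.inv_simple i
    have hbb : b⁻¹ = b := cs.inv_simple j
    have hb2 : b * b = 1 := cs.simple_mul_simple_self j
    have hconj : ∀ k : ℕ, ((a * b) ^ k)⁻¹ * b = b * (a * b) ^ k := by
      intro k
      have : b * (a * b) ^ k * b⁻¹ = ((a * b) ^ k)⁻¹ := by
        rw [← conj_pow, ← inv_pow]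
        simp [haa, hbb, mul_assoc, hb2]
      rw [← this]; simp
    have h1 : ((a * b) ^ n * t * ((a * b) ^ n)⁻¹ = b) ↔ t = b * (a * b) ^ (2 * n) := by
      rw [mul_inv_eq_iff_eq_mul, ← eq_inv_mul_iff_mul_eq, ← mul_assoc, hconj, mul_assoc, ← pow_add,
        two_mul]
    have h2 : (b * ((a * b) ^ n * t * ((a * b) ^ n)⁻¹) * b = a) ↔
        t = b * (a * b) ^ (2 * n + 1) := by
      have h (x : W) : b * x * b = a ↔ x = b * (a * b) := by
        constructor
        · rintro h
          rw [← h, mul_assoc _ b b, hb2, mul_one, ← mul_assoc, hb2, one_mul]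
        · rintro rfl
          rw [← mul_assoc, hb2, one_mul, mul_assoc, hb2, mul_one]
      rw [h, mul_inv_eq_iff_eq_mul, ← eq_inv_mul_iff_mul_eq, ← mul_assoc, ← mul_assoc, hconj,
        mul_assoc, mul_assoc, ← pow_succ', ← pow_add]
      ring_nf
    rw [pow_succ', Equiv.Perm.mul_apply, ih, Equiv.Perm.mul_apply, simplePerm_apply,
      simplePerm_apply, Nat.mul_succ, Finset.sum_range_succ, Finset.sum_range_succ]
    simp only [← ha, ← hb]
    simp only [h1, h2]
    ext
    · simp [pow_succ', mul_assoc, haa, hbb]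
    · simp [add_assoc]

theorem isLiftable_simplePerm : M.IsLiftable (simplePerm cs) := by
  intro i j
  ext1 ⟨t, e⟩
  rw [simplePerm_mul_pow_apply, cs.simple_mul_simple_pow, two_mul, Finset.sum_range_add]
  simp [pow_add, cs.simple_mul_simple_pow, CharTwo.add_self_eq_zero]

/-- The action of `W` on `W × {±1}` by signed conjugation. -/
noncomputable def hom : W →* Equiv.Perm (W × ZMod 2) :=
  cs.lift ⟨simplePerm cs, isLiftable_simplePerm cs⟩

/-- The sign picked up by `t` under `w`. -/
noncomputable def sign (w t : W) : ZMod 2 := (hom cs w (t, 0)).2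

theorem hom_simple (i : B) : hom cs (cs.simple i) = simplePerm cs i :=
  cs.lift_apply_simple (isLiftable_simplePerm cs) i

theorem hom_wordProd (l : List B) (t : W) (e : ZMod 2) :
    hom cs (cs.wordProd l) (t, e) =
      (cs.wordProd l * t * (cs.wordProd l)⁻¹, e + ((cs.rightInvSeq l).count t : ZMod 2)) := by
  induction l with
  | nil => simp
  | cons i l ih =>
    have h : cs.wordProd l * t * (cs.wordProd l)⁻¹ = cs.simple i ↔
        (cs.wordProd l)⁻¹ * cs.simple i * cs.wordProd l = t := by
      rw [mul_inv_eq_iff_eq_mul, ← eq_inv_mul_iff_mul_eq, mul_assoc, eq_comm]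
    rw [cs.wordProd_cons, map_mul, Equiv.Perm.mul_apply, ih, hom_simple, simplePerm_apply,
      CoxeterSystem.rightInvSeq, List.count_cons]
    simp only [h]
    ext
    · simp [mul_assoc]
    · by_cases h' : (cs.wordProd l)⁻¹ * cs.simple i * cs.wordProd l = t <;> simp [h', add_assoc]

theorem sign_wordProd (l : List B) (t : W) :
    sign cs (cs.wordProd l) t = ((cs.rightInvSeq l).count t : ZMod 2) := by
  simp [sign, hom_wordProd]

theorem hom_apply (w t : W) (e : ZMod 2) :
    hom cs w (t, e) = (w * t * w⁻¹, e + sign cs w t) := by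
  obtain ⟨l, rfl⟩ := cs.wordProd_surjective w
  rw [sign_wordProd, hom_wordProd]

theorem sign_mul_apply (a b t : W) : sign cs (a * b) t = sign cs b t + sign cs a (b * t * b⁻¹) := by
  have := hom_apply cs (a * b) t 0
  rw [map_mul, Equiv.Perm.mul_apply, hom_apply, hom_apply] at this
  simpa using (congrArg Prod.snd this).symm

theorem sign_one_apply (t : W) : sign cs 1 t = 0 := by simp [sign]

theorem sign_inv_conj (w t : W) : sign cs w⁻¹ (w * t * w⁻¹) = sign cs w t := by
  have := sign_mul_apply cs w⁻¹ w t
  rw [inv_mul_cancel, sign_one_apply] at this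
  exact (CharTwo.add_eq_zero.mp this.symm).symm

theorem sign_simple (i : B) (t : W) :
    sign cs (cs.simple i) t = if t = cs.simple i then 1 else 0 := by
  simp [sign, hom_simple, simplePerm_apply]

variable {cs}

theorem sign_conj_simple (x : W) (i : B) (r : W) :
    sign cs (x * cs.simple i * x⁻¹) r =
      sign cs x⁻¹ r + (if x⁻¹ * r * x = cs.simple i then 1 else 0) +
        sign cs x (cs.simple i * (x⁻¹ * r * x) * cs.simple i) := by
  rw [sign_mul_apply, sign_mul_apply, sign_simple]
  simp [add_assoc]

theorem sign_self {t : W} (ht : cs.IsReflection t) : sign cs t t = 1 := by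
  obtain ⟨x, i, rfl⟩ := ht
  rw [sign_conj_simple]
  have h := sign_inv_conj cs x (cs.simple i)
  simp only [mul_assoc] at *
  simp [h]
  rw [add_right_comm, CharTwo.add_self_eq_zero, zero_add]

theorem sign_eq_zero_of_commute {t r : W} (ht : cs.IsReflection t) (hr : t * r = r * t)
    (hne : r ≠ t) : sign cs t r = 0 := by
  obtain ⟨x, i, rfl⟩ := ht
  rw [sign_conj_simple]
  set q := x⁻¹ * r * x with hq
  have hrq : r = x * q * x⁻¹ := by simp [hq, mul_assoc]
  have h1 : q ≠ cs.simple i := by rintro h; exact hne (by rw [hrq, h])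
  have h2 : cs.simple i * q * cs.simple i = q := by
    rw [hrq] at hr
    have h : x * (cs.simple i * q) * x⁻¹ = x * (q * cs.simple i) * x⁻¹ := by
      simpa [mul_assoc] using hr
    rw [mul_left_cancel (mul_right_cancel h), cs.simple_mul_simple_cancel_right]
  rw [h2, if_neg h1, hrq, sign_inv_conj]
  simp [CharTwo.add_self_eq_zero]

theorem exists_sublist_of_sign {l : List B} {t : W} (h : sign cs (cs.wordProd l) t ≠ 0) :
    t ∈ cs.rightInvSeq l ∧ ∃ n < l.length, cs.wordProd (l.eraseIdx n) = cs.wordProd l * t := by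
  rw [sign_wordProd] at h
  have hmem : t ∈ cs.rightInvSeq l := by
    by_contra hn
    exact h (by rw [List.count_eq_zero_of_not_mem hn]; simp)
  refine ⟨hmem, ?_⟩
  obtain ⟨n, hn, rfl⟩ := List.getElem_of_mem hmem
  rw [cs.length_rightInvSeq] at hn
  refine ⟨n, hn, ?_⟩
  rw [← cs.wordProd_mul_getD_rightInvSeq, List.getD_eq_getElem]

theorem length_mul_lt_of_sign {w t : W} (h : sign cs w t ≠ 0) :
    cs.length (w * t) < cs.length w := by
  obtain ⟨l, hl, rfl⟩ := cs.exists_isReduced w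
  obtain ⟨-, n, hn, he⟩ := exists_sublist_of_sign h
  rw [← he, hl.eq]
  have := cs.length_wordProd_le (l.eraseIdx n)
  rw [List.length_eraseIdx_of_lt hn] at this
  omega

theorem sign_ne_zero_iff {w t : W} (ht : cs.IsReflection t) :
    sign cs w t ≠ 0 ↔ cs.length (w * t) < cs.length w := by
  refine ⟨length_mul_lt_of_sign, fun h h0 ↦ ?_⟩
  have h1 : sign cs (w * t) t ≠ 0 := by
    rw [sign_mul_apply, sign_self ht]
    simp [h0]
  have := length_mul_lt_of_sign h1
  rw [mul_assoc, ht.mul_self, mul_one] at this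
  omega

theorem sign_eq_one_iff {w t : W} (ht : cs.IsReflection t) :
    sign cs w t = 1 ↔ cs.length (w * t) < cs.length w := by
  rw [← sign_ne_zero_iff ht]
  generalize sign cs w t = e
  revert e; decide

theorem sign_eq_zero_iff {w t : W} (ht : cs.IsReflection t) :
    sign cs w t = 0 ↔ cs.length w < cs.length (w * t) := by
  rw [← not_iff_not, ← ne_eq, sign_ne_zero_iff ht, not_lt]
  have := ht.length_mul_left_ne w
  omega

end SignedConj

section Bruhat

open SignedConj

variable {cs : CoxeterSystem M W}

theorem exists_eraseIdx_of_isRightDescent {l : List B} {i : B}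
    (h : cs.IsRightDescent (cs.wordProd l) i) :
    ∃ n < l.length, cs.wordProd (l.eraseIdx n) = cs.wordProd l * cs.simple i :=
  (exists_sublist_of_sign ((sign_ne_zero_iff (cs.isReflection_simple i)).mpr h)).2

theorem exists_isReduced_sublist (cs : CoxeterSystem M W) (l : List B) :
    ∃ l' : List B, l'.Sublist l ∧ cs.IsReduced l' ∧ cs.wordProd l' = cs.wordProd l := by
  induction l using List.reverseRecOn with
  | nil => exact ⟨[], List.Sublist.refl _, by simp [CoxeterSystem.IsReduced], rfl⟩
  | append_singleton l i ih =>
    obtain ⟨l', hsub, hred, hprod⟩ := ih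
    by_cases h : cs.IsRightDescent (cs.wordProd l') i
    · obtain ⟨n, hn, he⟩ := exists_eraseIdx_of_isRightDescent h
      refine ⟨l'.eraseIdx n, ((List.eraseIdx_sublist _ _).trans hsub).trans
        (List.sublist_append_left _ _), ?_, ?_⟩
      · have h1 := cs.isRightDescent_iff.mp h
        have h2 := List.length_eraseIdx_add_one hn
        rw [CoxeterSystem.IsReduced, he]
        rw [hred.eq] at h1
        omega
      · rw [he, cs.wordProd_append, hprod, cs.wordProd_singleton]
    · refine ⟨l' ++ [i], hsub.append (List.Sublist.refl _), ?_, ?_⟩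
      · rw [CoxeterSystem.IsReduced, cs.wordProd_append, cs.wordProd_singleton,
          cs.not_isRightDescent_iff.mp h, hred.eq]
        simp
      · simp [cs.wordProd_append, hprod]

/-- The Bruhat order as the reflexive transitive closure of length-increasing multiplication by
reflections. -/
def BruhatChain (cs : CoxeterSystem M W) : W → W → Prop :=
  Relation.ReflTransGen fun u v ↦
    ∃ t, cs.IsReflection t ∧ v = u * t ∧ cs.length u < cs.length v

namespace BruhatChain

theorem of_lt {u t : W} (ht : cs.IsReflection t) (h : cs.length u < cs.length (u * t)) :
    BruhatChain cs u (u * t) :=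
  Relation.ReflTransGen.single ⟨t, ht, rfl, h⟩

theorem refl (u : W) : BruhatChain cs u u := Relation.ReflTransGen.refl

theorem trans {u v w : W} (h : BruhatChain cs u v) (h' : BruhatChain cs v w) :
    BruhatChain cs u w := Relation.ReflTransGen.trans h h'

theorem length_lt {u v : W} (h : BruhatChain cs u v) : u = v ∨ cs.length u < cs.length v := by
  induction h with
  | refl => exact Or.inl rfl
  | tail _ h ih =>
    obtain ⟨t, -, -, hlt⟩ := h
    rcases ih with rfl | ih
    · exact Or.inr hlt
    · exact Or.inr (ih.trans hlt)

theorem exists_sublist {u v : W} (h : BruhatChain cs u v) (l : List B) (hl : cs.wordProd l = v) :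
    ∃ l' : List B, l'.Sublist l ∧ cs.wordProd l' = u := by
  induction h generalizing l with
  | refl => exact ⟨l, List.Sublist.refl _, hl⟩
  | @tail w v _ h ih =>
    obtain ⟨t, ht, rfl, hlt⟩ := h
    have : sign cs (cs.wordProd l) t ≠ 0 := by
      rw [sign_ne_zero_iff ht, hl, mul_assoc, ht.mul_self, mul_one]
      exact hlt
    obtain ⟨-, n, -, hn⟩ := exists_sublist_of_sign this
    rw [hl, mul_assoc, ht.mul_self, mul_one] at hn
    obtain ⟨l', hsub, hl'⟩ := ih _ hn
    exact ⟨l', hsub.trans (List.eraseIdx_sublist _ _), hl'⟩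

theorem mul_simple_or {u v : W} (h : BruhatChain cs u v) (i : B) :
    BruhatChain cs (u * cs.simple i) (v * cs.simple i) ∨ BruhatChain cs (u * cs.simple i) v := by
  induction h with
  | refl => exact Or.inl (refl _)
  | @tail w v _ h ih =>
    rcases ih with ih | ih
    swap
    · exact Or.inr (Relation.ReflTransGen.tail ih h)
    obtain ⟨t, ht, rfl, hlt⟩ := h
    have hw := of_lt ht hlt
    by_cases hti : t = cs.simple i
    · subst hti
      exact Or.inr ih
    have ht' : cs.IsReflection (cs.simple i * t * cs.simple i) := by
      simpa using ht.conj (cs.simple i)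
    have he : w * t * cs.simple i = w * cs.simple i * (cs.simple i * t * cs.simple i) := by
      simp [mul_assoc]
    by_cases h1 : cs.length (w * cs.simple i) < cs.length (w * t * cs.simple i)
    · rw [he] at h1 ⊢
      exact Or.inl (ih.trans (of_lt ht' h1))
    rcases cs.length_mul_simple w i with h2 | h2
    · exfalso
      have hs : sign cs (w * cs.simple i) (cs.simple i * t * cs.simple i) = 0 := by
        have : cs.simple i * t * cs.simple i ≠ cs.simple i := by
          intro h
          apply hti
          have h' : cs.simple i * t = 1 := by simpa using h
          rw [eq_inv_of_mul_eq_one_right h', cs.inv_simple]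
        rw [sign_mul_apply, sign_simple, if_neg this, zero_add]
        simpa [mul_assoc] using (sign_eq_zero_iff ht).mpr hlt
      rw [sign_eq_zero_iff ht', ← he] at hs
      exact h1 hs
    · have h3 : BruhatChain cs (w * cs.simple i) w := by
        have := of_lt (cs := cs) (u := w * cs.simple i) (cs.isReflection_simple i)
          (by simp; omega)
        simpa using this
      exact Or.inr ((ih.trans h3).trans hw)

theorem mul_simple {u : W} {i : B} (h : ¬ cs.IsRightDescent u i) :
    BruhatChain cs u (u * cs.simple i) :=
  of_lt (cs.isReflection_simple i) (by rw [cs.not_isRightDescent_iff.mp h]; omega)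

theorem mul_simple_of_descent {u : W} {i : B} (h : cs.IsRightDescent u i) :
    BruhatChain cs (u * cs.simple i) u := by
  have := mul_simple (cs.isRightDescent_iff_not_isRightDescent_mul.mp h)
  simpa using this

theorem of_sublist {l l' : List B} (hl : cs.IsReduced l) (h : l'.Sublist l) :
    BruhatChain cs (cs.wordProd l') (cs.wordProd l) := by
  induction l using List.reverseRecOn generalizing l' with
  | nil => rw [List.sublist_nil.mp h]; exact refl _
  | append_singleton l i ih =>
    have hred : cs.IsReduced l := by simpa using hl.take l.length
    have hstep : BruhatChain cs (cs.wordProd l) (cs.wordProd l * cs.simple i) := by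
      apply of_lt (cs.isReflection_simple i)
      have := hl.eq
      rw [cs.wordProd_append, cs.wordProd_singleton] at this
      rw [this, hred.eq]
      simp
    rw [cs.wordProd_append, cs.wordProd_singleton]
    obtain ⟨l₁, l₂, rfl, h1, h2⟩ := List.sublist_append_iff.mp h
    have hc := ih hred h1
    rcases List.sublist_singleton.mp h2 with rfl | rfl
    · rw [List.append_nil]
      exact hc.trans hstep
    · rw [cs.wordProd_append, cs.wordProd_singleton]
      rcases hc.mul_simple_or i with h | h
      · exact h
      · exact h.trans hstep

end BruhatChain

theorem bruhatLE_iff {u v : W} : bruhatLE cs u v ↔ BruhatChain cs u v := by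
  refine ⟨fun h ↦ ?_, fun h l _ hl ↦ h.exists_sublist l hl⟩
  obtain ⟨l, hl, rfl⟩ := cs.exists_isReduced v
  obtain ⟨l', hsub, rfl⟩ := h l hl rfl
  exact BruhatChain.of_sublist hl hsub

namespace bruhatLE

theorem refl (u : W) : bruhatLE cs u u := bruhatLE_iff.mpr (BruhatChain.refl u)

theorem trans {u v w : W} (h : bruhatLE cs u v) (h' : bruhatLE cs v w) : bruhatLE cs u w :=
  bruhatLE_iff.mpr ((bruhatLE_iff.mp h).trans (bruhatLE_iff.mp h'))

theorem antisymm {u v : W} (h : bruhatLE cs u v) (h' : bruhatLE cs v u) : u = v := by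
  rcases (bruhatLE_iff.mp h).length_lt with h1 | h1
  · exact h1
  · rcases (bruhatLE_iff.mp h').length_lt with h2 | h2
    · exact h2.symm
    · omega

theorem inv {u v : W} (h : bruhatLE cs u v) : bruhatLE cs u⁻¹ v⁻¹ := by
  rintro l hl hv
  obtain ⟨l', hsub, hl'⟩ := h l.reverse ((cs.isReduced_reverse_iff l).mpr hl)
    (by rw [cs.wordProd_reverse, hv, inv_inv])
  exact ⟨l'.reverse, List.reverse_sublist.mp (by simpa using hsub),
    by rw [cs.wordProd_reverse, hl']⟩

theorem one_le (v : W) : bruhatLE cs 1 v := fun l _ _ ↦ ⟨[], List.nil_sublist l, cs.wordProd_nil⟩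

theorem mul_simple_le {v : W} {i : B} (hv : cs.IsRightDescent v i) :
    bruhatLE cs (v * cs.simple i) v :=
  bruhatLE_iff.mpr (BruhatChain.mul_simple_of_descent hv)

theorem simple_mul_le {v : W} {i : B} (hv : cs.IsLeftDescent v i) :
    bruhatLE cs (cs.simple i * v) v := by
  rw [← cs.isRightDescent_inv_iff] at hv
  simpa using (mul_simple_le hv).inv

theorem le_mul_simple {u v : W} {i : B} (h : bruhatLE cs u v)
    (hu : ¬ cs.IsRightDescent u i) : bruhatLE cs u (v * cs.simple i) := by
  rw [bruhatLE_iff] at h ⊢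
  obtain ⟨l, hl, he⟩ := cs.exists_isReduced (v * cs.simple i)
  have hli : cs.wordProd (l ++ [i]) = v := by simp [cs.wordProd_append, ← he]
  obtain ⟨l', hsub, rfl⟩ := h.exists_sublist _ hli
  rw [he]
  obtain ⟨l₁, l₂, rfl, h1, h2⟩ := List.sublist_append_iff.mp hsub
  rcases List.sublist_singleton.mp h2 with rfl | rfl
  · rw [List.append_nil]
    exact BruhatChain.of_sublist hl h1
  · rw [cs.wordProd_append, cs.wordProd_singleton] at hu ⊢
    obtain ⟨n, -, hn⟩ := exists_eraseIdx_of_isRightDescent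
      (cs.isRightDescent_iff_not_isRightDescent_mul.mpr hu)
    rw [← hn]
    exact BruhatChain.of_sublist hl ((List.eraseIdx_sublist _ _).trans h1)

theorem mul_simple_le_of_le {u v : W} {i : B} (h : bruhatLE cs u v)
    (hv : cs.IsRightDescent v i) (hu : ¬ cs.IsRightDescent u i) :
    bruhatLE cs (u * cs.simple i) v := by
  have h1 := bruhatLE_iff.mp (h.le_mul_simple hu)
  rw [bruhatLE_iff]
  rcases h1.mul_simple_or i with h2 | h2
  · simpa using h2
  · exact h2.trans (BruhatChain.mul_simple_of_descent hv)

theorem le_simple_mul {u v : W} {i : B} (h : bruhatLE cs u v)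
    (hu : ¬ cs.IsLeftDescent u i) : bruhatLE cs u (cs.simple i * v) := by
  rw [← cs.isRightDescent_inv_iff] at hu
  simpa using (h.inv.le_mul_simple hu).inv

theorem simple_mul_le_of_le {u v : W} {i : B} (h : bruhatLE cs u v)
    (hv : cs.IsLeftDescent v i) (hu : ¬ cs.IsLeftDescent u i) :
    bruhatLE cs (cs.simple i * u) v := by
  rw [← cs.isRightDescent_inv_iff] at hv hu
  simpa using (h.inv.mul_simple_le_of_le hv hu).inv

end bruhatLE

theorem bruhatLT.length_lt {u v : W} (h : bruhatLT cs u v) : cs.length u < cs.length v :=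
  (bruhatLE_iff.mp h.1).length_lt.resolve_left h.2

theorem exists_isReflection_of_bruhatLT {u v : W} (h : bruhatLT cs u v)
    (hl : cs.length v ≤ cs.length u + 1) : ∃ t, cs.IsReflection t ∧ u = v * t := by
  obtain ⟨w, hw, t, ht, rfl, hlt⟩ :=
    (Relation.ReflTransGen.cases_tail (bruhatLE_iff.mp h.1)).resolve_left fun e ↦ h.2 e.symm
  rcases BruhatChain.length_lt hw with rfl | h1
  · exact ⟨t, ht, by rw [mul_assoc, ht.mul_self, mul_one]⟩
  · omega

end Bruhat

section Dihedral

open SignedConj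

variable {cs : CoxeterSystem M W}

theorem exists_isReduced_of_mem_closure {i j : B} {y : W}
    (hy : y ∈ Subgroup.closure {cs.simple i, cs.simple j}) :
    ∃ l : List B, cs.IsReduced l ∧ (∀ k ∈ l, k = i ∨ k = j) ∧ cs.wordProd l = y := by
  suffices h : ∃ l : List B, (∀ k ∈ l, k = i ∨ k = j) ∧ cs.wordProd l = y by
    obtain ⟨l, hl, rfl⟩ := h
    obtain ⟨l', hsub, hred, he⟩ := exists_isReduced_sublist cs l
    exact ⟨l', hred, fun k hk ↦ hl k (hsub.subset hk), he⟩
  induction hy using Subgroup.closure_induction with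
  | mem x hx =>
    rcases hx with rfl | rfl
    · exact ⟨[i], by simp, by simp⟩
    · exact ⟨[j], by simp, by simp⟩
  | one => exact ⟨[], by simp, by simp⟩
  | mul x y _ _ hx hy =>
    obtain ⟨l, hl, rfl⟩ := hx
    obtain ⟨l', hl', rfl⟩ := hy
    refine ⟨l ++ l', fun k hk ↦ ?_, cs.wordProd_append l l'⟩
    rcases List.mem_append.mp hk with hk | hk
    · exact hl k hk
    · exact hl' k hk
  | inv x _ hx =>
    obtain ⟨l, hl, rfl⟩ := hx
    exact ⟨l.reverse, fun k hk ↦ hl k (List.mem_reverse.mp hk), cs.wordProd_reverse l⟩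

theorem wordProd_mem_closure {i j : B} {l : List B} (hl : ∀ k ∈ l, k = i ∨ k = j) :
    cs.wordProd l ∈ Subgroup.closure {cs.simple i, cs.simple j} := by
  induction l with
  | nil => simp
  | cons k l ih =>
    rw [cs.wordProd_cons]
    refine mul_mem (Subgroup.subset_closure ?_) (ih fun k hk ↦ hl k (List.mem_cons_of_mem _ hk))
    rcases hl k List.mem_cons_self with rfl | rfl <;> simp

theorem mem_closure_of_sign {i j : B} {y r : W}
    (hy : y ∈ Subgroup.closure {cs.simple i, cs.simple j}) (h : sign cs y r ≠ 0) :
    r ∈ Subgroup.closure {cs.simple i, cs.simple j} := by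
  obtain ⟨l, -, hl, rfl⟩ := exists_isReduced_of_mem_closure hy
  obtain ⟨-, n, -, hn⟩ := exists_sublist_of_sign h
  have := wordProd_mem_closure (cs := cs) fun k hk ↦ hl k ((List.eraseIdx_sublist l n).subset hk)
  rw [hn] at this
  exact (Subgroup.mul_mem_cancel_left _ hy).mp this

theorem exists_isRightDescent_of_mem_closure {i j : B} {y : W}
    (hy : y ∈ Subgroup.closure {cs.simple i, cs.simple j}) (h1 : y ≠ 1) :
    cs.IsRightDescent y i ∨ cs.IsRightDescent y j := by
  obtain ⟨l, hred, hl, rfl⟩ := exists_isReduced_of_mem_closure hy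
  induction l using List.reverseRecOn with
  | nil => simp at h1
  | append_singleton l k _ =>
    have h : cs.IsRightDescent (cs.wordProd (l ++ [k])) k := by
      have h2 := cs.length_wordProd_le l
      rw [CoxeterSystem.IsRightDescent, hred.eq, cs.wordProd_append, cs.wordProd_singleton,
        cs.simple_mul_simple_cancel_right, List.length_append, List.length_singleton]
      omega
    rcases hl k (by simp) with rfl | rfl
    · exact Or.inl h
    · exact Or.inr h

theorem eq_wordProd_alternatingWord {i j : B} {y : W}
    (hy : y ∈ Subgroup.closure {cs.simple i, cs.simple j}) (h : cs.IsRightDescent y j) :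
    y = cs.wordProd (CoxeterSystem.alternatingWord i j (cs.length y)) := by
  induction hn : cs.length y generalizing y i j with
  | zero =>
    rw [cs.length_eq_zero_iff] at hn
    simp [hn, CoxeterSystem.alternatingWord]
  | succ n ih =>
    have hlen := cs.isRightDescent_iff.mp h
    have hmem : y * cs.simple j ∈ Subgroup.closure {cs.simple j, cs.simple i} := by
      rw [Set.pair_comm]
      exact mul_mem hy (Subgroup.subset_closure (by simp))
    have hys : y * cs.simple j =
        cs.wordProd (CoxeterSystem.alternatingWord j i n) := by
      by_cases h1 : y * cs.simple j = 1
      · have : n = 0 := by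
          rw [h1, cs.length_one] at hlen
          omega
        subst this
        simpa [CoxeterSystem.alternatingWord] using h1
      · refine ih hmem ((exists_isRightDescent_of_mem_closure hmem h1).resolve_left ?_) (by omega)
        exact cs.isRightDescent_iff_not_isRightDescent_mul.mp h
    rw [CoxeterSystem.alternatingWord_succ, cs.wordProd_concat, ← hys,
      cs.simple_mul_simple_cancel_right]

theorem length_mul_of_mem_closure {i j : B} {d y : W}
    (hd : ∀ r ∈ Subgroup.closure {cs.simple i, cs.simple j}, sign cs d r = 0)
    (hy : y ∈ Subgroup.closure {cs.simple i, cs.simple j}) :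
    cs.length (d * y) = cs.length d + cs.length y := by
  obtain ⟨l, hred, hl, rfl⟩ := exists_isReduced_of_mem_closure hy
  clear hy
  induction l using List.reverseRecOn with
  | nil => simp
  | append_singleton l k ih =>
    have hred' : cs.IsReduced l := by simpa using hred.take l.length
    have hl' : ∀ k ∈ l, k = i ∨ k = j := fun k hk ↦ hl k (by simp [hk])
    have hk : cs.simple k ∈ Subgroup.closure {cs.simple i, cs.simple j} := by
      apply Subgroup.subset_closure
      rcases hl k (by simp) with rfl | rfl <;> simp
    have hmem := wordProd_mem_closure (cs := cs) hl'
    have h0 : sign cs (cs.wordProd l) (cs.simple k) = 0 := by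
      rw [sign_eq_zero_iff (cs.isReflection_simple k), ← cs.wordProd_singleton,
        ← cs.wordProd_append, hred.eq, hred'.eq]
      simp
    have h1 : sign cs (d * cs.wordProd l) (cs.simple k) = 0 := by
      rw [sign_mul_apply, h0, hd _ (mul_mem (mul_mem hmem hk) (inv_mem hmem)), zero_add]
    rw [sign_eq_zero_iff (cs.isReflection_simple k)] at h1
    have h2 := cs.length_mul_simple (d * cs.wordProd l) k
    rw [hred.eq, cs.wordProd_append, cs.wordProd_singleton, ← mul_assoc]
    have h3 := ih hred' hl'
    rw [hred'.eq] at h3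
    simp only [List.length_append, List.length_singleton]
    omega

theorem eq_simple_of_mem_closure {i j : B} {y : W}
    (hy : y ∈ Subgroup.closure {cs.simple i, cs.simple j}) (h : cs.length y = 1) :
    y = cs.simple i ∨ y = cs.simple j := by
  obtain ⟨l, hred, hl, rfl⟩ := exists_isReduced_of_mem_closure hy
  rw [hred.eq, List.length_eq_one_iff] at h
  obtain ⟨k, rfl⟩ := h
  rcases hl k (by simp) with rfl | rfl <;> simp

theorem pow_length_eq_one_of_isRightDescent {i j : B} {z : W}
    (hz : z ∈ Subgroup.closure {cs.simple i, cs.simple j}) (hi : cs.IsRightDescent z i)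
    (hj : cs.IsRightDescent z j) : (cs.simple i * cs.simple j) ^ cs.length z = 1 := by
  have h1 := eq_wordProd_alternatingWord hz hj
  have h2 := eq_wordProd_alternatingWord (Set.pair_comm _ _ ▸ hz) hi
  rw [cs.prod_alternatingWord_eq_mul_pow] at h1 h2
  have hinv : (cs.simple j * cs.simple i) = (cs.simple i * cs.simple j)⁻¹ := by simp
  have h := h1.symm.trans h2
  rcases Nat.even_or_odd' (cs.length z) with ⟨n, hn | hn⟩
  · have he : Even (cs.length z) := ⟨n, by omega⟩
    rw [if_pos he, if_pos he, one_mul, one_mul, hinv, inv_pow, eq_inv_iff_mul_eq_one, ← pow_add]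
      at h
    rwa [show cs.length z = cs.length z / 2 + cs.length z / 2 by omega]
  · have he : ¬ Even (cs.length z) := by
      rw [Nat.not_even_iff_odd]
      exact ⟨n, hn⟩
    rw [if_neg he, if_neg he, hinv, inv_pow, eq_mul_inv_iff_mul_eq, mul_assoc, ← pow_add] at h
    have h' : cs.simple i * (cs.simple j *
        (cs.simple i * cs.simple j) ^ (cs.length z / 2 + cs.length z / 2)) = 1 := by
      rw [h, cs.simple_mul_simple_self]
    rw [← mul_assoc, ← pow_succ'] at h'
    rwa [show cs.length z = cs.length z / 2 + cs.length z / 2 + 1 by omega]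

end Dihedral

section Automorphism

open SignedConj

variable {cs : CoxeterSystem M W} {θ : W ≃* W}

theorem length_map (hθ : Function.Involutive θ)
    (hθS : ∀ i : B, ∃ j : B, θ (cs.simple i) = cs.simple j) (w : W) :
    cs.length (θ w) = cs.length w := by
  have hle : ∀ w, cs.length (θ w) ≤ cs.length w := by
    intro w
    choose σ hσ using hθS
    have h : ∀ l, θ (cs.wordProd l) = cs.wordProd (l.map σ) := by
      intro l
      induction l with
      | nil => simp
      | cons i l ih => simp [cs.wordProd_cons, hσ, ih]
    obtain ⟨l, hl, rfl⟩ := cs.exists_isReduced w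
    rw [h, hl.eq]
    simpa using cs.length_wordProd_le (l.map σ)
  refine le_antisymm (hle w) ?_
  simpa only [hθ w] using hle (θ w)

theorem isReflection_map (hθS : ∀ i : B, ∃ j : B, θ (cs.simple i) = cs.simple j) {t : W}
    (ht : cs.IsReflection t) : cs.IsReflection (θ t) := by
  obtain ⟨x, i, rfl⟩ := ht
  obtain ⟨j, hj⟩ := hθS i
  exact ⟨θ x, j, by simp [hj]⟩

theorem sign_map (hθ : Function.Involutive θ)
    (hθS : ∀ i : B, ∃ j : B, θ (cs.simple i) = cs.simple j) (w : W) {t : W}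
    (ht : cs.IsReflection t) : sign cs (θ w) (θ t) = sign cs w t := by
  have h : sign cs (θ w) (θ t) = 1 ↔ sign cs w t = 1 := by
    rw [sign_eq_one_iff ht, sign_eq_one_iff (isReflection_map hθS ht), ← map_mul,
      length_map hθ hθS, length_map hθ hθS]
  generalize sign cs (θ w) (θ t) = a at h ⊢
  generalize sign cs w t = b at h ⊢
  revert a b
  decide

theorem sign_eq_zero_of_mem_twistedIdentities (hθ : Function.Involutive θ)
    (hθS : ∀ i : B, ∃ j : B, θ (cs.simple i) = cs.simple j) {u r : W}
    (hu : u ∈ twistedIdentities θ) (hr : cs.IsReflection r) (h : u * r * u⁻¹ = θ r) :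
    sign cs u r = 0 := by
  obtain ⟨c, rfl⟩ := hu
  have hq : θ (c * r * c⁻¹) = c * r * c⁻¹ := by
    rw [map_mul, map_mul, ← h]
    simp [mul_assoc]
  rw [sign_mul_apply, ← hq, sign_map hθ hθS _ (hr.conj c), sign_inv_conj,
    CharTwo.add_self_eq_zero]

theorem length_simple_conj_lt {t : W} {i : B} (ht : cs.IsReflection t)
    (h : cs.IsRightDescent t i) (hne : cs.simple i ≠ t) :
    cs.simple i * t ≠ t * cs.simple i ∧
      cs.length (cs.simple i * t * cs.simple i) < cs.length t := by
  have h1 : sign cs t (cs.simple i) = 1 := (sign_eq_one_iff (cs.isReflection_simple i)).mpr h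
  have hcomm : cs.simple i * t ≠ t * cs.simple i := by
    intro hc
    rw [sign_eq_zero_of_commute ht hc.symm hne] at h1
    exact zero_ne_one h1
  refine ⟨hcomm, ?_⟩
  have h2 : sign cs (cs.simple i * t) (cs.simple i) = 1 := by
    rw [sign_mul_apply, h1, sign_simple, if_neg, add_zero]
    intro h
    rw [mul_inv_eq_iff_eq_mul] at h
    exact hcomm h.symm
  rw [sign_eq_one_iff (cs.isReflection_simple i)] at h2
  have h3 : cs.length (cs.simple i * t) = cs.length (t * cs.simple i) := by
    rw [← cs.length_inv, mul_inv_rev, ht.inv, cs.inv_simple]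
  have h4 : cs.length (t * cs.simple i) < cs.length t := h
  omega

theorem exists_map_eq_length_conj_lt (hθ : Function.Involutive θ)
    (hθS : ∀ i : B, ∃ j : B, θ (cs.simple i) = cs.simple j) {i j : B}
    (hij : θ (cs.simple i) = cs.simple j) (hne : cs.simple i ≠ cs.simple j)
    (hord : Even (orderOf (cs.simple i * cs.simple j))) {t : W}
    (ht : cs.IsReflection t) (hθt : θ t = t) (hi : cs.IsRightDescent t i) :
    ∃ z, θ z = z ∧ cs.length (z * t * z⁻¹) < cs.length t := by
  have hji : θ (cs.simple j) = cs.simple i := by rw [← hij, hθ]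
  have hit : cs.simple i ≠ t := by
    rintro rfl
    exact hne (hθt.symm.trans hij)
  have hti : sign cs t (cs.simple i) = 1 := (sign_eq_one_iff (cs.isReflection_simple i)).mpr hi
  have htj : sign cs t (cs.simple j) = 1 := by
    rw [← hti, ← sign_map hθ hθS t (cs.isReflection_simple i), hθt, hij]
  set K := Subgroup.closure {cs.simple i, cs.simple j} with hK
  have hiK : cs.simple i ∈ K := Subgroup.subset_closure (by simp)
  have hjK : cs.simple j ∈ K := Subgroup.subset_closure (by simp)
  obtain ⟨y, hy, hmin⟩ : ∃ y ∈ K, ∀ y' ∈ K, cs.length (t * y) ≤ cs.length (t * y') := by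
    obtain ⟨y, hy, hmin⟩ := (measure fun y ↦ cs.length (t * y)).wf.has_min (K : Set W)
      ⟨1, K.one_mem⟩
    exact ⟨y, hy, fun y' hy' ↦ not_lt.mp (hmin y' hy')⟩
  obtain ⟨z, rfl⟩ : ∃ z, y = z⁻¹ := ⟨y⁻¹, (inv_inv y).symm⟩
  have hz : z ∈ K := inv_mem_iff.mp hy
  obtain ⟨d, hd⟩ : ∃ d, d = t * z⁻¹ := ⟨_, rfl⟩
  have htd : t = d * z := by rw [hd, inv_mul_cancel_right]
  have hd0 : ∀ r ∈ K, sign cs d r = 0 := by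
    intro r hr
    by_contra h
    have h1 := length_mul_lt_of_sign h
    have h2 := hmin (z⁻¹ * r) (mul_mem hy hr)
    rw [← mul_assoc, ← hd] at h2
    omega
  have hlt : cs.length t = cs.length d + cs.length z := by
    rw [htd]
    exact length_mul_of_mem_closure hd0 hz
  have hzK : ∀ r ∈ K, sign cs z r = sign cs t r := by
    intro r hr
    rw [htd, sign_mul_apply, hd0 _ (mul_mem (mul_mem hz hr) (inv_mem hz)), add_zero]
  have hzi : cs.IsRightDescent z i := by
    rw [CoxeterSystem.IsRightDescent, ← sign_eq_one_iff (cs.isReflection_simple i), hzK _ hiK, hti]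
  have hzj : cs.IsRightDescent z j := by
    rw [CoxeterSystem.IsRightDescent, ← sign_eq_one_iff (cs.isReflection_simple j), hzK _ hjK, htj]
  have hpow := pow_length_eq_one_of_isRightDescent hz hzi hzj
  obtain ⟨n, hn⟩ := (hord.two_dvd.trans (orderOf_dvd_of_pow_eq_one hpow))
  have hzn : z = (cs.simple i * cs.simple j) ^ n := by
    have := eq_wordProd_alternatingWord hz hzj
    rw [cs.prod_alternatingWord_eq_mul_pow, if_pos ⟨n, by omega⟩, one_mul,
      show cs.length z / 2 = n by omega] at this
    exact this
  have hinv : (cs.simple i * cs.simple j)⁻¹ = cs.simple j * cs.simple i := by simp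
  have hz2 : z⁻¹ = z := by
    rw [inv_eq_iff_mul_eq_one]
    nth_rw 1 2 [hzn]
    rw [← pow_add, ← two_mul, ← hn, hpow]
  have hzn' : z = (cs.simple j * cs.simple i) ^ n := by
    rw [← hz2, ← hinv, inv_pow, ← hzn]
  have hθz : θ z = z := by
    nth_rw 1 [hzn]
    rw [map_pow, map_mul, hij, hji, ← hzn']
  have hzcomm : ∀ k, k = i ∨ k = j → z * cs.simple k = cs.simple k * z := by
    have hc : z * cs.simple i = cs.simple i * z := by
      have := mul_pow_mul (cs.simple i) (cs.simple j) n
      rw [← hzn, ← hzn'] at this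
      exact this
    rintro k (rfl | rfl)
    · exact hc
    · rw [← hij, ← hθz, ← map_mul, hc, map_mul]
  refine ⟨z, hθz, ?_⟩
  by_contra hcon
  have hzd : z * t * z⁻¹ = z * d := by rw [hd, mul_assoc]
  rw [not_lt, hzd] at hcon
  have hdi : sign cs d⁻¹ (cs.simple i) = 0 := by
    by_contra h
    have h1 := length_mul_lt_of_sign h
    rw [← cs.length_inv, ← cs.length_inv d⁻¹, mul_inv_rev, inv_inv, cs.inv_simple] at h1
    have h2 : cs.length (z * cs.simple i) < cs.length z := hzi
    have h3 := cs.length_mul_le (z * cs.simple i) (cs.simple i * d)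
    rw [mul_assoc, cs.simple_mul_simple_cancel_left] at h3
    omega
  obtain ⟨hcomm, -⟩ := length_simple_conj_lt ht hi hit
  obtain ⟨r, hr⟩ : ∃ r, r = d⁻¹ * cs.simple i * d := ⟨_, rfl⟩
  have hrK : r ∈ K := by
    apply mem_closure_of_sign (mul_mem hiK hz)
    have h1 : sign cs (cs.simple i * t) (cs.simple i) = 1 := by
      rw [sign_mul_apply, hti, sign_simple, if_neg, add_zero]
      intro h
      rw [mul_inv_eq_iff_eq_mul] at h
      exact hcomm h.symm
    have h2 : cs.simple i * t = cs.simple i * z * d⁻¹ := by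
      nth_rw 1 [← ht.inv, htd]
      rw [mul_inv_rev, hz2, mul_assoc]
    rw [h2, sign_mul_apply, hdi, zero_add, inv_inv, ← hr] at h1
    rw [h1]
    exact one_ne_zero
  have hrlen : cs.length r = 1 := by
    have h1 : cs.simple i * d = d * r := by simp [hr, mul_assoc]
    have h2 : cs.length (d * r) = cs.length d + cs.length r := length_mul_of_mem_closure hd0 hrK
    rw [← h1] at h2
    rw [sign_eq_zero_iff (cs.isReflection_simple i), ← cs.length_inv, ← cs.length_inv (_ * _),
      mul_inv_rev, inv_inv, cs.inv_simple] at hdi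
    have h3 := cs.length_simple_mul d i
    omega
  have htr : t * cs.simple i * t = r := by
    have h1 : t * cs.simple i * t = z⁻¹ * r * z := by
      nth_rw 1 [← ht.inv]
      rw [htd, hr]
      simp [mul_assoc]
    have h2 : r * z = z * r := by
      rcases eq_simple_of_mem_closure hrK hrlen with h | h <;> rw [h, hzcomm _ (by simp)]
    rw [h1, mul_assoc, h2, inv_mul_cancel_left]
  rcases eq_simple_of_mem_closure hrK hrlen with hri | hrj
  · rw [hri] at htr
    apply hcomm
    nth_rw 1 [← htr]
    rw [mul_assoc, ht.mul_self, mul_one]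
  · rw [hrj] at htr
    have htt := ht.mul_self
    have hsq : cs.simple i * cs.simple j = (cs.simple i * t) ^ 2 := by
      rw [← htr, pow_two]
      simp only [mul_assoc]
    have hzt : z = (cs.simple i * t) ^ n * (cs.simple i * t) ^ n := by
      rw [← pow_add, ← two_mul, pow_mul, ← hsq, hzn]
    have hswap : t * (cs.simple i * t) ^ n = (t * cs.simple i) ^ n * t :=
      (mul_pow_mul t (cs.simple i) n).symm
    have hti_inv : ((cs.simple i * t) ^ n)⁻¹ = (t * cs.simple i) ^ n := by
      rw [← inv_pow, mul_inv_rev, ht.inv, cs.inv_simple]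
    have hdr : t * z = (t * cs.simple i) ^ n * t * ((t * cs.simple i) ^ n)⁻¹ := by
      rw [hzt, ← mul_assoc, hswap, ← hti_inv, inv_inv]
    have hrefl : cs.IsReflection (t * z) := by
      rw [hdr]
      exact ht.conj _
    have htz : t * z = z * t := by
      calc t * z = (t * z)⁻¹ := hrefl.inv.symm
        _ = z * t := by rw [mul_inv_rev, hz2, ht.inv]
    have hz1 : t * z ≠ t := by
      intro h
      rw [mul_eq_left.mp h] at hzi
      exact cs.not_isRightDescent_one i hzi
    have h0 := sign_eq_zero_of_commute ht (r := t * z) (by rw [htz, ← mul_assoc, htz]) hz1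
    rw [sign_eq_zero_iff hrefl, ← mul_assoc, htt, one_mul] at h0
    omega

theorem exists_conj_eq_simple (hθ : Function.Involutive θ)
    (hθS : ∀ i : B, ∃ j : B, θ (cs.simple i) = cs.simple j) (hNOF : NOF cs θ) {t : W}
    (ht : cs.IsReflection t) (hθt : θ t = t) :
    ∃ g i, θ g = g ∧ g * t * g⁻¹ = cs.simple i := by
  induction hn : cs.length t using Nat.strong_induction_on generalizing t with
  | _ n ih =>
    have hstep : ∀ z, θ z = z → cs.length (z * t * z⁻¹) < cs.length t →
        ∃ g i, θ g = g ∧ g * t * g⁻¹ = cs.simple i := by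
      intro z hz hlt
      obtain ⟨g, i, hg, hgi⟩ := ih _ (hn ▸ hlt) (ht.conj z) (by simp [hz, hθt]) rfl
      exact ⟨g * z, i, by simp [hg, hz], by rw [← hgi]; simp [mul_assoc]⟩
    have ht1 : t ≠ 1 := by
      rintro rfl
      have := sign_self ht
      rw [sign_one_apply] at this
      exact zero_ne_one this
    obtain ⟨i, hi⟩ := cs.exists_rightDescent_of_ne_one ht1
    by_cases hit : cs.simple i = t
    · exact ⟨1, i, map_one θ, by simp [hit]⟩
    by_cases hfix : θ (cs.simple i) = cs.simple i
    · apply hstep _ hfix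
      rw [cs.inv_simple]
      exact (length_simple_conj_lt ht hi hit).2
    · obtain ⟨j, hj⟩ := hθS i
      have hord : Even (orderOf (cs.simple i * cs.simple j)) := by
        rw [← hj]
        rcases hNOF i hfix with h | h
        · exact h
        · rw [h]
          exact Even.zero
      obtain ⟨z, hz, hlt⟩ := exists_map_eq_length_conj_lt hθ hθS hj
        (fun h ↦ hfix (hj.trans h.symm)) hord ht hθt hi
      exact hstep z hz hlt

end Automorphism

theorem bruhatLE.trans_lt {cs : CoxeterSystem M W} {u v w : W} (h : bruhatLE cs u v)
    (h' : bruhatLT cs v w) : bruhatLT cs u w :=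
  ⟨h.trans h'.1, by rintro rfl; exact h'.2 (h'.1.antisymm h)⟩

section TwistedInvolutions

open SignedConj

variable {cs : CoxeterSystem M W} {θ : W ≃* W}

theorem twistAct_mem (hθ : Function.Involutive θ) {w : W} (hw : w ∈ twistedInvolutions θ)
    (i : B) : twistAct cs θ w i ∈ twistedInvolutions θ := by
  have hw' : θ w = w⁻¹ := hw
  unfold twistAct
  split_ifs with h
  · have h' := congrArg (· ⁻¹) h
    simp only [mul_inv_rev, cs.inv_simple, ← map_inv] at h'
    change θ (w * cs.simple i) = (w * cs.simple i)⁻¹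
    rw [map_mul, hw', mul_inv_rev, cs.inv_simple, ← h']
    simp only [mul_assoc, ← map_mul, cs.simple_mul_simple_self, map_one, mul_one]
    rw [h']
  · change θ (_ * _) = _
    rw [map_mul, map_mul, hθ, hw', mul_inv_rev, mul_inv_rev, ← map_inv, cs.inv_simple, mul_assoc]

theorem twistAct_twistAct (w : W) (i : B) : twistAct cs θ (twistAct cs θ w i) i = w := by
  have h2 : θ (cs.simple i) * θ (cs.simple i) = 1 := by rw [← map_mul]; simp
  by_cases h : θ (cs.simple i) * w * cs.simple i = w
  · have h1 : twistAct cs θ w i = w * cs.simple i := if_pos h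
    rw [h1, twistAct, if_pos, cs.simple_mul_simple_cancel_right]
    rw [← mul_assoc, h]
  · have h1 : twistAct cs θ w i = θ (cs.simple i) * w * cs.simple i := if_neg h
    have h3 : θ (cs.simple i) * (θ (cs.simple i) * w * cs.simple i) * cs.simple i = w := by
      simp only [← mul_assoc, h2, one_mul]
      simp
    rw [h1, twistAct, h3, if_neg fun h' ↦ h h'.symm]

theorem twistAct_injective (i : B) : Function.Injective fun w ↦ twistAct cs θ w i :=
  Function.LeftInverse.injective (g := fun w ↦ twistAct cs θ w i) fun w ↦ twistAct_twistAct w i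

theorem isLeftDescent_iff_isRightDescent (hθ : Function.Involutive θ)
    (hθS : ∀ i : B, ∃ j : B, θ (cs.simple i) = cs.simple j) {i j : B}
    (hij : θ (cs.simple i) = cs.simple j) {w : W} (hw : w ∈ twistedInvolutions θ) :
    cs.IsLeftDescent w j ↔ cs.IsRightDescent w i := by
  have hw' : θ w = w⁻¹ := hw
  rw [CoxeterSystem.IsLeftDescent, CoxeterSystem.IsRightDescent, ← length_map hθ hθS (_ * _),
    map_mul, ← hij, hθ, hw', ← cs.length_inv (_ * _), mul_inv_rev, inv_inv, cs.inv_simple]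

theorem isLeftDescent_mul_simple_iff {i j : B} {w : W}
    (h : cs.simple j * w * cs.simple i ≠ w) :
    cs.IsLeftDescent (w * cs.simple i) j ↔ cs.IsLeftDescent w j := by
  rw [← cs.isRightDescent_inv_iff, ← cs.isRightDescent_inv_iff, CoxeterSystem.IsRightDescent,
    CoxeterSystem.IsRightDescent, ← sign_eq_one_iff (cs.isReflection_simple j),
    ← sign_eq_one_iff (cs.isReflection_simple j), mul_inv_rev, sign_mul_apply, cs.inv_simple,
    sign_simple, if_neg, add_zero]
  intro h'
  apply h
  rw [← h']
  simp [mul_assoc]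

theorem twistAct_cases {i j : B} (hij : θ (cs.simple i) = cs.simple j) (w : W) :
    twistAct cs θ w i = w * cs.simple i ∨
      cs.simple j * w * cs.simple i ≠ w ∧
        twistAct cs θ w i = cs.simple j * (w * cs.simple i) := by
  unfold twistAct
  rw [hij]
  split_ifs with h
  · exact Or.inl rfl
  · exact Or.inr ⟨h, mul_assoc _ _ _⟩

theorem isRightDescent_twistAct (hθ : Function.Involutive θ)
    (hθS : ∀ i : B, ∃ j : B, θ (cs.simple i) = cs.simple j) {w : W}
    (hw : w ∈ twistedInvolutions θ) (i : B) :
    cs.IsRightDescent (twistAct cs θ w i) i ↔ ¬ cs.IsRightDescent w i := by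
  obtain ⟨j, hij⟩ := hθS i
  rcases twistAct_cases hij w with h | ⟨hne, h⟩
  · rw [h, cs.isRightDescent_iff_not_isRightDescent_mul, cs.simple_mul_simple_cancel_right]
  · rw [← isLeftDescent_iff_isRightDescent hθ hθS hij (twistAct_mem hθ hw i), h,
      cs.isLeftDescent_iff_not_isLeftDescent_mul, cs.simple_mul_simple_cancel_left,
      isLeftDescent_mul_simple_iff hne, isLeftDescent_iff_isRightDescent hθ hθS hij hw]

theorem le_twistAct (hθ : Function.Involutive θ)
    (hθS : ∀ i : B, ∃ j : B, θ (cs.simple i) = cs.simple j) {u v : W}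
    (hu : u ∈ twistedInvolutions θ) (h : bruhatLE cs u v) {i : B}
    (hui : ¬ cs.IsRightDescent u i) : bruhatLE cs u (twistAct cs θ v i) := by
  obtain ⟨j, hij⟩ := hθS i
  have h1 := h.le_mul_simple hui
  rcases twistAct_cases hij v with h | ⟨-, h⟩
  · rwa [h]
  · rw [h]
    exact h1.le_simple_mul (by rwa [isLeftDescent_iff_isRightDescent hθ hθS hij hu])

theorem twistAct_le (hθ : Function.Involutive θ)
    (hθS : ∀ i : B, ∃ j : B, θ (cs.simple i) = cs.simple j) {u v : W}
    (hu : u ∈ twistedInvolutions θ) (hv : v ∈ twistedInvolutions θ) (h : bruhatLE cs u v) {i : B}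
    (hvi : cs.IsRightDescent v i) (hui : ¬ cs.IsRightDescent u i) :
    bruhatLE cs (twistAct cs θ u i) v := by
  obtain ⟨j, hij⟩ := hθS i
  have h1 := h.mul_simple_le_of_le hvi hui
  rcases twistAct_cases hij u with h | ⟨hne, h⟩
  · rwa [h]
  · rw [h]
    refine h1.simple_mul_le_of_le ?_ ?_
    · rwa [isLeftDescent_iff_isRightDescent hθ hθS hij hv]
    · rwa [isLeftDescent_mul_simple_iff hne, isLeftDescent_iff_isRightDescent hθ hθS hij hu]

theorem twistAct_lt (hθ : Function.Involutive θ)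
    (hθS : ∀ i : B, ∃ j : B, θ (cs.simple i) = cs.simple j) {w : W}
    (hw : w ∈ twistedInvolutions θ) {i : B} (hi : cs.IsRightDescent w i) :
    bruhatLT cs (twistAct cs θ w i) w := by
  have hd := isRightDescent_twistAct hθ hθS hw i
  refine ⟨?_, fun h ↦ ?_⟩
  · obtain ⟨j, hij⟩ := hθS i
    have h1 := bruhatLE.mul_simple_le hi
    rcases twistAct_cases hij w with h | ⟨hne, h⟩
    · rwa [h]
    · rw [h]
      refine (bruhatLE.simple_mul_le ?_).trans h1
      rwa [isLeftDescent_mul_simple_iff hne, isLeftDescent_iff_isRightDescent hθ hθS hij hw]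
  · rw [h] at hd
    exact hd.mp hi hi

/-- The cover relation in the Bruhat order on twisted involutions. -/
def TwistedCovBy (cs : CoxeterSystem M W) (θ : W ≃* W) (u v : W) : Prop :=
  bruhatLT cs u v ∧ ¬ ∃ w ∈ twistedInvolutions θ, bruhatLT cs u w ∧ bruhatLT cs w v

theorem TwistedCovBy.eq_twistAct (hθ : Function.Involutive θ)
    (hθS : ∀ i : B, ∃ j : B, θ (cs.simple i) = cs.simple j) {u v : W}
    (hu : u ∈ twistedInvolutions θ) (hv : v ∈ twistedInvolutions θ) (h : TwistedCovBy cs θ u v)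
    {i : B} (hvi : cs.IsRightDescent v i) (hui : ¬ cs.IsRightDescent u i) :
    u = twistAct cs θ v i := by
  by_contra hne
  exact h.2 ⟨_, twistAct_mem hθ hv i, ⟨le_twistAct hθ hθS hu h.1.1 hui, hne⟩,
    twistAct_lt hθ hθS hv hvi⟩

theorem TwistedCovBy.twistAct (hθ : Function.Involutive θ)
    (hθS : ∀ i : B, ∃ j : B, θ (cs.simple i) = cs.simple j) {u v : W}
    (hu : u ∈ twistedInvolutions θ) (hv : v ∈ twistedInvolutions θ) (h : TwistedCovBy cs θ u v)
    {i : B} (hvi : cs.IsRightDescent v i) (hui : cs.IsRightDescent u i) :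
    TwistedCovBy cs θ (twistAct cs θ u i) (twistAct cs θ v i) := by
  have hu' := twistAct_mem (cs := cs) hθ hu i
  have hui' : ¬ cs.IsRightDescent (TwistedIdentitiesPaper.twistAct cs θ u i) i := by
    rwa [isRightDescent_twistAct hθ hθS hu, not_not]
  have hult := twistAct_lt hθ hθS hu hui
  have hvlt := twistAct_lt hθ hθS hv hvi
  refine ⟨⟨le_twistAct hθ hθS hu' (hult.1.trans h.1.1) hui',
    fun he ↦ h.1.2 (twistAct_injective i he)⟩, ?_⟩
  rintro ⟨w, hw, huw, hwv⟩
  by_cases hwi : cs.IsRightDescent w i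
  · have h1 := twistAct_le hθ hθS hu' hw huw.1 hwi hui'
    rw [twistAct_twistAct] at h1
    exact h.2 ⟨_, twistAct_mem hθ hv i, h1.trans_lt hwv, hvlt⟩
  · have hw' := twistAct_mem (cs := cs) hθ hw i
    have hwi' := (isRightDescent_twistAct hθ hθS hw i).mpr hwi
    have hwle := (twistAct_lt hθ hθS hw' hwi').1
    rw [twistAct_twistAct] at hwle
    have h1 := twistAct_le hθ hθS hw hv (hwv.1.trans hvlt.1) hvi hwi
    have h2 := twistAct_le hθ hθS hu' hw' (huw.1.trans hwle) hwi' hui'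
    rw [twistAct_twistAct] at h2
    refine h.2 ⟨_, hw', ⟨h2, ?_⟩, h1, ?_⟩
    · rintro rfl
      exact huw.2 (twistAct_twistAct w i)
    · rintro rfl
      exact hwv.2 (twistAct_twistAct w i).symm

/-- `TwistedChain cs θ v k` holds if there is a saturated chain of length `k` from `1` to `v` in
the Bruhat order on twisted involutions. -/
inductive TwistedChain (cs : CoxeterSystem M W) (θ : W ≃* W) : W → ℕ → Prop
  | one : TwistedChain cs θ 1 0
  | cons {u v : W} {k : ℕ} : TwistedChain cs θ u k → v ∈ twistedInvolutions θ →
      TwistedCovBy cs θ u v → TwistedChain cs θ v (k + 1)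

namespace TwistedChain

theorem mem {v : W} {k : ℕ} (h : TwistedChain cs θ v k) : v ∈ twistedInvolutions θ := by
  cases h with
  | one => simp [twistedInvolutions]
  | cons _ hv _ => exact hv

theorem eq_zero {k : ℕ} (h : TwistedChain cs θ 1 k) : k = 0 := by
  cases h with
  | one => rfl
  | cons _ _ hc =>
    have := hc.1.length_lt
    simp at this

theorem descent (hθ : Function.Involutive θ)
    (hθS : ∀ i : B, ∃ j : B, θ (cs.simple i) = cs.simple j) {v : W} {k : ℕ}
    (h : TwistedChain cs θ v k) {i : B} (hi : cs.IsRightDescent v i) :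
    ∃ m, k = m + 1 ∧ TwistedChain cs θ (twistAct cs θ v i) m := by
  induction h with
  | one => exact absurd hi (cs.not_isRightDescent_one i)
  | @cons u v k hu hv hc ih =>
    by_cases hui : cs.IsRightDescent u i
    · obtain ⟨m, rfl, hm⟩ := ih hui
      exact ⟨m + 1, rfl, hm.cons (twistAct_mem hθ hv i) (hc.twistAct hθ hθS hu.mem hv hi hui)⟩
    · exact ⟨k, rfl, hc.eq_twistAct hθ hθS hu.mem hv hi hui ▸ hu⟩

theorem exists_of_mem {v : W} (hv : v ∈ twistedInvolutions θ) : ∃ k, TwistedChain cs θ v k := by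
  induction hn : cs.length v using Nat.strong_induction_on generalizing v with
  | _ n ih =>
    subst hn
    by_cases hv1 : v = 1
    · exact ⟨0, hv1 ▸ one⟩
    obtain ⟨u, ⟨hu, huv⟩, hmax⟩ :
        ∃ u ∈ {u | u ∈ twistedInvolutions θ ∧ bruhatLT cs u v},
          ∀ w ∈ {u | u ∈ twistedInvolutions θ ∧ bruhatLT cs u v},
            ¬ cs.length v - cs.length w < cs.length v - cs.length u :=
      (measure fun u ↦ cs.length v - cs.length u).wf.has_min _
        ⟨1, by simp [twistedInvolutions], bruhatLE.one_le v, fun h ↦ hv1 h.symm⟩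
    obtain ⟨k, hk⟩ := ih _ huv.length_lt hu rfl
    refine ⟨k + 1, hk.cons hv ⟨huv, ?_⟩⟩
    rintro ⟨w, hw, huw, hwv⟩
    have := hmax w ⟨hw, hwv⟩
    have h1 := huw.length_lt
    have h2 := hwv.length_lt
    omega

theorem exists_twistProd_eq (hθ : Function.Involutive θ)
    (hθS : ∀ i : B, ∃ j : B, θ (cs.simple i) = cs.simple j) {v : W} {k : ℕ}
    (h : TwistedChain cs θ v k) : ∃ l : List B, l.length = k ∧ twistProd cs θ l = v := by
  induction k generalizing v with
  | zero =>
    cases h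
    exact ⟨[], rfl, rfl⟩
  | succ k ih =>
    have hv1 : v ≠ 1 := by
      rintro rfl
      exact k.succ_ne_zero h.eq_zero
    obtain ⟨i, hi⟩ := cs.exists_rightDescent_of_ne_one hv1
    obtain ⟨m, hm, hc⟩ := h.descent hθ hθS hi
    obtain ⟨l, hl, he⟩ := ih (Nat.succ_injective hm ▸ hc)
    refine ⟨l ++ [i], by simp [hl], ?_⟩
    unfold twistProd at he ⊢
    rw [List.foldl_append, he]
    exact twistAct_twistAct v i

theorem twistRank_le (hθ : Function.Involutive θ)
    (hθS : ∀ i : B, ∃ j : B, θ (cs.simple i) = cs.simple j) {v : W} {k : ℕ}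
    (h : TwistedChain cs θ v k) : twistRank cs θ v ≤ k :=
  Nat.sInf_le (h.exists_twistProd_eq hθ hθS)

theorem length_eq_of_mem_twistedIdentities (hθ : Function.Involutive θ)
    (hθS : ∀ i : B, ∃ j : B, θ (cs.simple i) = cs.simple j) {u : W} {k : ℕ}
    (h : TwistedChain cs θ u k) (hu : u ∈ twistedIdentities θ) : cs.length u = 2 * k := by
  induction k generalizing u with
  | zero =>
    cases h
    simp
  | succ k ih =>
    have hu1 : u ≠ 1 := by
      rintro rfl
      exact k.succ_ne_zero h.eq_zero
    obtain ⟨i, hi⟩ := cs.exists_rightDescent_of_ne_one hu1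
    obtain ⟨m, hm, hc⟩ := h.descent hθ hθS hi
    obtain rfl := Nat.succ_injective hm
    obtain ⟨j, hij⟩ := hθS i
    rcases twistAct_cases hij u with h1 | ⟨hne, h1⟩
    · exfalso
      have hfix : θ (cs.simple i) * u * cs.simple i = u := by
        by_contra hne
        rw [twistAct, if_neg hne, mul_assoc, mul_eq_right] at h1
        apply hne
        rw [h1, one_mul]
        have h2 := cs.length_simple i
        rw [(map_eq_one_iff θ θ.injective).mp h1] at h2
        simp at h2
      have h0 := sign_eq_zero_of_mem_twistedIdentities hθ hθS hu (cs.isReflection_simple i) (by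
        rw [mul_inv_eq_iff_eq_mul]
        nth_rw 1 [← hfix]
        simp)
      rw [sign_eq_zero_iff (cs.isReflection_simple i)] at h0
      exact lt_asymm h0 hi
    · have hu' : twistAct cs θ u i ∈ twistedIdentities θ := by
        obtain ⟨a, rfl⟩ := hu
        exact ⟨a * cs.simple i, by rw [h1, ← hij]; simp [mul_assoc]⟩
      have h2 := ih hc hu'
      have h3 : cs.IsLeftDescent (u * cs.simple i) j := by
        rwa [isLeftDescent_mul_simple_iff hne,
          isLeftDescent_iff_isRightDescent hθ hθS hij h.mem]
      rw [cs.isLeftDescent_iff, ← h1] at h3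
      rw [cs.isRightDescent_iff] at hi
      omega

end TwistedChain

theorem mem_twistedInvolutions_of_mem_twistedIdentities (hθ : Function.Involutive θ) {u : W}
    (hu : u ∈ twistedIdentities θ) : u ∈ twistedInvolutions θ := by
  obtain ⟨a, rfl⟩ := hu
  change θ _ = _
  rw [map_mul, hθ, mul_inv_rev, ← map_inv, inv_inv]

theorem exists_isReflection_of_twistedCovBy (hθ : Function.Involutive θ)
    (hθS : ∀ i : B, ∃ j : B, θ (cs.simple i) = cs.simple j) {u v : W}
    (hv : v ∈ twistedInvolutions θ) (h1 : 2 * twistRank cs θ v = cs.length v + 1)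
    (hu : u ∈ twistedIdentities θ) (hcov : TwistedCovBy cs θ u v) :
    ∃ r, cs.IsReflection r ∧ u = v * r ∧ u * r * u⁻¹ = θ r := by
  have huI := mem_twistedInvolutions_of_mem_twistedIdentities hθ hu
  obtain ⟨k, hk⟩ := TwistedChain.exists_of_mem (cs := cs) huI
  have hle := (hk.cons hv hcov).twistRank_le hθ hθS
  have hlen := hk.length_eq_of_mem_twistedIdentities hθ hθS hu
  obtain ⟨r, hr, hur⟩ := exists_isReflection_of_bruhatLT hcov.1 (by omega)
  refine ⟨r, hr, hur, ?_⟩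
  have hu' : θ u = u⁻¹ := huI
  have hv' : θ v = v⁻¹ := hv
  rw [hur, map_mul, hv', inv_mul_eq_iff_eq_mul] at hu'
  rw [hu', hur, mul_assoc v r r, hr.mul_self, mul_one]

theorem eq_simple_of_mem_twistedIdentities (hθ : Function.Involutive θ)
    (hθS : ∀ i : B, ∃ j : B, θ (cs.simple i) = cs.simple j) {p : W} {i : B}
    (hp : cs.IsReflection p) (hθp : θ p = cs.simple i * p * cs.simple i)
    (hmem : cs.simple i * p ∈ twistedIdentities θ) : p = cs.simple i := by
  by_contra hne
  have h0 := sign_eq_zero_of_mem_twistedIdentities hθ hθS hmem hp (by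
    rw [hθp, mul_inv_rev, cs.inv_simple]
    simp [mul_assoc])
  rw [sign_mul_apply, sign_self hp, sign_simple, if_neg, add_zero] at h0
  · exact one_ne_zero h0
  · rwa [mul_inv_cancel_right]

end TwistedInvolutions

theorem statement10 [Finite B] (cs : CoxeterSystem M W) (θ : W ≃* W)
    (hθ : Function.Involutive θ)
    (hθS : ∀ i : B, ∃ j : B, θ (cs.simple i) = cs.simple j)
    (hNOF : NOF cs θ)
    (v : W) (hv : v ∈ twistedInvolutions θ)
    (h1 : 2 * twistRank cs θ v = cs.length v + 1)
    (u u' : W) (hu : u ∈ twistedIdentities θ) (hu' : u' ∈ twistedIdentities θ)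
    (hcov : bruhatLT cs u v ∧
      ¬ ∃ w ∈ twistedInvolutions θ, bruhatLT cs u w ∧ bruhatLT cs w v)
    (hcov' : bruhatLT cs u' v ∧
      ¬ ∃ w ∈ twistedInvolutions θ, bruhatLT cs u' w ∧ bruhatLT cs w v) :
    u = u' := by
  obtain ⟨r, hr, hur, hθr⟩ := exists_isReflection_of_twistedCovBy hθ hθS hv h1 hu hcov
  obtain ⟨r', hr', hur', hθr'⟩ := exists_isReflection_of_twistedCovBy hθ hθS hv h1 hu' hcov'
  have hvu : v = u * r := by rw [hur, mul_assoc, hr.mul_self, mul_one]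
  obtain ⟨a, ha⟩ := hu
  have hθt : θ (a * r * a⁻¹) = a * r * a⁻¹ := by
    rw [map_mul, map_mul, ← hθr, ha]
    simp [mul_assoc]
  obtain ⟨g, i, hg, hgi⟩ := exists_conj_eq_simple hθ hθS hNOF (hr.conj a) hθt
  obtain ⟨b, hb⟩ : ∃ b, b = g * a := ⟨_, rfl⟩
  have hub : u = θ b⁻¹ * b := by
    rw [ha, hb, mul_inv_rev, map_mul, map_inv θ g, hg]
    simp [mul_assoc]
  have hri : b * r * b⁻¹ = cs.simple i := by
    rw [← hgi, hb]
    simp [mul_assoc]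
  have hrb : r = b⁻¹ * cs.simple i * b := by
    rw [← hri]
    simp [mul_assoc]
  have hu'b : u' = θ b⁻¹ * cs.simple i * b * r' := by
    rw [hur', hvu, hub, hrb]
    simp [mul_assoc]
  have key : b * r' * b⁻¹ = cs.simple i := by
    apply eq_simple_of_mem_twistedIdentities hθ hθS (hr'.conj b)
    · rw [map_mul, map_mul, ← hθr', hu'b]
      simp only [mul_inv_rev, cs.inv_simple, map_inv, inv_inv, mul_assoc, hr'.inv,
        mul_inv_cancel_left, mul_inv_cancel, mul_one]
      rw [← mul_assoc r' r', hr'.mul_self, one_mul]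
    · obtain ⟨c, hc⟩ := hu'
      refine ⟨c * b⁻¹, ?_⟩
      rw [mul_inv_rev, inv_inv, map_mul, mul_assoc (θ b), ← mul_assoc (θ c⁻¹), ← hc, hu'b]
      simp [mul_assoc]
  have hrr : r = r' := by
    rw [hrb, ← key]
    simp [mul_assoc]
  rw [hur, hur', hrr]

end TwistedIdentitiesPaper
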